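/- If G is a minimal counterexample, then G contains no cycle of length 3. -/

import Mathlib

open SimpleGraph

/-- A `(1,2^k)`-packing edge-coloring encoded as a function assigning a color in
`Fin (k+1)` to each unordered pair. Color `0` is the 1-color (its class must be a
matching) and each color `i ≠ 0` is a 2-color (its class must be an induced matching). -/
def IsPackingEC {V : Type} (G : SimpleGraph V) (k : ℕ)
    (c : Sym2 V → Fin (k + 1)) : Prop :=
  (∀ a b x y : V, G.Adj a b → G.Adj x y → s(a, b) ≠ s(x, y) →
      c s(a, b) = 0 → c s(x, y) = 0 →
      a ≠ x ∧ a ≠ y ∧ b ≠ x ∧ b ≠ y) ∧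
  ∀ a b x y : V, G.Adj a b → G.Adj x y → s(a, b) ≠ s(x, y) →
      c s(a, b) = c s(x, y) → c s(a, b) ≠ 0 →
      (a ≠ x ∧ a ≠ y ∧ b ≠ x ∧ b ≠ y) ∧
      ¬G.Adj a x ∧ ¬G.Adj a y ∧ ¬G.Adj b x ∧ ¬G.Adj b y

/-- A good coloring: a `(1,2^7)`-packing edge-coloring in which every edge of the
1-color class (color `0`) has both endpoints of degree 3. -/
def GoodColoring {V : Type} (G : SimpleGraph V) (c : Sym2 V → Fin 8) : Prop :=
  IsPackingEC G 7 c ∧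
  ∀ a b : V, G.Adj a b → c s(a, b) = 0 →
    (G.neighborSet a).ncard = 3 ∧ (G.neighborSet b).ncard = 3

/-- A graph is subcubic if every vertex has degree at most 3. -/
def Subcubic {V : Type} (G : SimpleGraph V) : Prop :=
  ∀ v : V, (G.neighborSet v).ncard ≤ 3

/-- A minimal counterexample: a finite subcubic simple graph with no good coloring such
that every finite subcubic simple graph with smaller `|V| + |E|` has a good coloring. -/
def MinCounter (V : Type) [Finite V] (G : SimpleGraph V) : Prop :=
  Subcubic G ∧
  (¬∃ c : Sym2 V → Fin 8, GoodColoring G c) ∧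
  ∀ (W : Type) [Finite W] (H : SimpleGraph W), Subcubic H →
    Nat.card W + H.edgeSet.ncard < Nat.card V + G.edgeSet.ncard →
    ∃ c : Sym2 W → Fin 8, GoodColoring H c

lemma exists_ne_zero_notMem (A : Finset (Fin 8)) (hA : A.card ≤ 6) :
    ∃ x, x ≠ 0 ∧ x ∉ A := by
  have h : (insert 0 A).card < (Finset.univ : Finset (Fin 8)).card := by
    have := Finset.card_insert_le 0 A
    simp only [Finset.card_univ, Fintype.card_fin]
    omega
  obtain ⟨x, -, hx⟩ := Finset.exists_mem_notMem_of_card_lt_card h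
  exact ⟨x, by grind, by grind⟩

/-- Colors for the pendant edges: `0` at the indices outside `B`, and distinct nonzero colors
avoiding the lists `F i` at the indices in `B`. -/
lemma exists_pendant_colors (F : Fin 3 → Finset (Fin 8)) (B : Finset (Fin 3))
    (hF : ∀ i ∈ B, (F i).card ≤ 3) :
    ∃ p : Fin 3 → Fin 8, (∀ i, p i = 0 ↔ i ∉ B) ∧ (∀ i ∈ B, p i ∉ F i) ∧
      ∀ i j, p i = p j → p i ≠ 0 → i = j := by
  have pick : ∀ (i : Fin 3) (C : Finset (Fin 8)), C.card ≤ 3 →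
      ∃ y, (y = 0 ↔ i ∉ B) ∧ (i ∈ B → y ∉ F i) ∧ (y ≠ 0 → y ∉ C) := by
    intro i C hC
    by_cases hi : i ∈ B
    · obtain ⟨y, hy, hyA⟩ := exists_ne_zero_notMem (F i ∪ C)
        ((Finset.card_union_le _ _).trans (by have := hF i hi; omega))
      exact ⟨y, by grind⟩
    · exact ⟨0, by grind⟩
  obtain ⟨y₀, h₀⟩ := pick 0 ∅ (by simp)
  obtain ⟨y₁, h₁⟩ := pick 1 {y₀} (by simp)
  obtain ⟨y₂, h₂⟩ := pick 2 {y₀, y₁} (Finset.card_le_two.trans (by simp))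
  refine ⟨![y₀, y₁, y₂], ?_, ?_, ?_⟩ <;> simp only [Fin.forall_fin_succ] <;> simp <;> grind

lemma exists_three_distinct (A₀ A₁ A₂ : Finset (Fin 8)) (h₀ : A₀.card ≤ 5)
    (h₁ : A₁.card ≤ 5) (h₂ : A₂.card ≤ 4) :
    ∃ y₀ y₁ y₂, (y₀ ≠ 0 ∧ y₀ ∉ A₀) ∧ (y₁ ≠ 0 ∧ y₁ ∉ A₁) ∧ (y₂ ≠ 0 ∧ y₂ ∉ A₂) ∧
      y₀ ≠ y₁ ∧ y₀ ≠ y₂ ∧ y₁ ≠ y₂ := by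
  obtain ⟨y₀, hy₀⟩ := exists_ne_zero_notMem A₀ (by omega)
  obtain ⟨y₁, hy₁⟩ := exists_ne_zero_notMem (insert y₀ A₁)
    ((Finset.card_insert_le _ _).trans (by omega))
  obtain ⟨y₂, hy₂⟩ := exists_ne_zero_notMem (insert y₁ (insert y₀ A₂))
    ((Finset.card_insert_le _ _).trans (by have := Finset.card_insert_le y₀ A₂; omega))
  exact ⟨y₀, y₁, y₂, by grind⟩

/-- Colors for the edges around a triangle: `p i` for the pendant edge at the `i`-th vertex and
`x i` for the triangle edge opposite to it. The list `S i` is forbidden for the two triangle edges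
at the `i`-th vertex, and `F i` for the pendant edge when it receives a nonzero color. -/
lemma exists_triangle_colors (S F : Fin 3 → Finset (Fin 8)) (B : Finset (Fin 3))
    (hS : ∀ i, (S i).card ≤ 2) (hSB : ∀ i ∈ B, (S i).card ≤ 1)
    (hF : ∀ i ∈ B, (F i).card ≤ 3) (h0 : ∀ i, 0 ∉ S i) :
    ∃ x p : Fin 3 → Fin 8, (∀ i, p i = 0 ↔ i ∉ B) ∧ (∀ i ∈ B, p i ∉ F i) ∧
      (∀ i j, p i = p j → p i ≠ 0 → i = j) ∧ Function.Injective x ∧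
      (∀ i j, p i ≠ x j) ∧ (∀ i j, i ≠ j → x i ∉ S j) ∧ ∀ i, x i = 0 → ∀ j, j ∈ B := by
  obtain ⟨p, hp0, hpF, hpp⟩ := exists_pendant_colors F B hF
  let Q : Fin 3 → Finset (Fin 8) := fun i => if i ∈ B then {p i} else ∅
  have hQ1 : ∀ i, (Q i).card ≤ 1 := by
    intro i
    by_cases hi : i ∈ B <;> simp [Q, hi]
  have hQS : ∀ i, (S i ∪ Q i).card ≤ 2 := by
    intro i
    by_cases hi : i ∈ B
    · exact (Finset.card_union_le _ _).trans (by have := hSB i hi; have := hQ1 i; omega)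
    · simpa [Q, hi] using hS i
  have hQmem : ∀ i y, y ≠ 0 → y ∉ Q i → p i ≠ y := by
    intro i y hy hyQ hpy
    by_cases hi : i ∈ B
    · simp [Q, hi, hpy] at hyQ
    · exact hy (hpy ▸ (hp0 i).2 hi)
  let A : Fin 3 → Fin 3 → Fin 3 → Finset (Fin 8) := fun i j k => (S j ∪ Q j) ∪ (S k ∪ Q k) ∪ Q i
  have hA : ∀ i j k, (A i j k).card ≤ 5 := by
    intro i j k
    refine (Finset.card_union_le _ _).trans ?_
    have := Finset.card_union_le (S j ∪ Q j) (S k ∪ Q k)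
    have := hQS j
    have := hQS k
    have := hQ1 i
    omega
  have hAgood : ∀ i j k, i ∉ B → (A i j k).card ≤ 4 := by
    intro i j k hi
    have := Finset.card_union_le (S j ∪ Q j) (S k ∪ Q k)
    have := hQS j
    have := hQS k
    simp only [A, Q, hi, if_false, Finset.union_empty] at *
    omega
  have hAmem : ∀ i j k y, y ≠ 0 → y ∉ A i j k →
      y ∉ S j ∧ y ∉ S k ∧ p i ≠ y ∧ p j ≠ y ∧ p k ≠ y := by
    intro i j k y hy hyA
    simp only [A, Finset.mem_union, not_or] at hyA
    exact ⟨hyA.1.1.1, hyA.1.2.1, hQmem i y hy hyA.2, hQmem j y hy hyA.1.1.2,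
      hQmem k y hy hyA.1.2.2⟩
  clear_value A
  suffices h : ∃ y₀ y₁ y₂ : Fin 8,
      ((y₀ ∉ S 1 ∧ y₀ ∉ S 2) ∧ (y₁ ∉ S 2 ∧ y₁ ∉ S 0) ∧ (y₂ ∉ S 0 ∧ y₂ ∉ S 1)) ∧
      (∀ i, p i ≠ y₀ ∧ p i ≠ y₁ ∧ p i ≠ y₂) ∧ (y₀ ≠ y₁ ∧ y₀ ≠ y₂ ∧ y₁ ≠ y₂) ∧
      (y₀ = 0 ∨ y₁ = 0 ∨ y₂ = 0 → ∀ j, j ∈ B) by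
    obtain ⟨y₀, y₁, y₂, hyS, hyp, hyy, hy0⟩ := h
    refine ⟨![y₀, y₁, y₂], p, hp0, hpF, hpp, ?_, ?_, ?_, ?_⟩
    · intro i j
      fin_cases i <;> fin_cases j <;> simp <;> grind
    · intro i j
      fin_cases j <;> simp [hyp i]
    · intro i j
      fin_cases i <;> fin_cases j <;> simp [hyS]
    · intro i
      fin_cases i <;> simp <;> grind
  by_cases hB : ∀ j, j ∈ B
  · obtain ⟨y₁, y₂, -, ⟨hy₁, hyA₁⟩, ⟨hy₂, hyA₂⟩, -, hne, -⟩ :=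
      exists_three_distinct (A 1 2 0) (A 2 0 1) ∅ (hA _ _ _) (hA _ _ _) (by simp)
    have h₁ := hAmem _ _ _ _ hy₁ hyA₁
    have h₂ := hAmem _ _ _ _ hy₂ hyA₂
    refine ⟨0, y₁, y₂, by grind, ?_, by grind, fun _ => hB⟩
    intro i
    have := hp0 i
    fin_cases i <;> simp at * <;> grind
  · push Not at hB
    obtain ⟨i, hi⟩ := hB
    have key : ∃ y₀ y₁ y₂, (y₀ ≠ 0 ∧ y₀ ∉ A 0 1 2) ∧ (y₁ ≠ 0 ∧ y₁ ∉ A 1 2 0) ∧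
        (y₂ ≠ 0 ∧ y₂ ∉ A 2 0 1) ∧ y₀ ≠ y₁ ∧ y₀ ≠ y₂ ∧ y₁ ≠ y₂ := by
      fin_cases i
      · obtain ⟨y₁, y₂, y₀, h₁, h₂, h₀, h₁₂, h₁₀, h₂₀⟩ :=
          exists_three_distinct (A 1 2 0) (A 2 0 1) (A 0 1 2)
          (hA _ _ _) (hA _ _ _) (hAgood _ _ _ hi)
        exact ⟨y₀, y₁, y₂, h₀, h₁, h₂, h₁₀.symm, h₂₀.symm, h₁₂⟩
      · obtain ⟨y₂, y₀, y₁, h₂, h₀, h₁, h₂₀, h₂₁, h₀₁⟩ :=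
          exists_three_distinct (A 2 0 1) (A 0 1 2) (A 1 2 0)
          (hA _ _ _) (hA _ _ _) (hAgood _ _ _ hi)
        exact ⟨y₀, y₁, y₂, h₀, h₁, h₂, h₀₁, h₂₀.symm, h₂₁.symm⟩
      · exact exists_three_distinct _ _ _ (hA _ _ _) (hA _ _ _) (hAgood _ _ _ hi)
    obtain ⟨y₀, y₁, y₂, ⟨hy₀, hyA₀⟩, ⟨hy₁, hyA₁⟩, ⟨hy₂, hyA₂⟩, hne⟩ := key
    have h₀ := hAmem _ _ _ _ hy₀ hyA₀
    have h₁ := hAmem _ _ _ _ hy₁ hyA₁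
    have h₂ := hAmem _ _ _ _ hy₂ hyA₂
    refine ⟨y₀, y₁, y₂, by grind, ?_, hne, by grind⟩
    intro i
    fin_cases i <;> simp at * <;> grind

lemma goodColoring_iff {V : Type} {G : SimpleGraph V} {c : Sym2 V → Fin 8} :
    GoodColoring G c ↔
      (∀ e ∈ G.edgeSet, ∀ f ∈ G.edgeSet, e ≠ f → c e = c f →
        ∀ a ∈ e, ∀ b ∈ f, a ≠ b ∧ (c e ≠ 0 → ¬G.Adj a b)) ∧
      ∀ e ∈ G.edgeSet, c e = 0 → ∀ a ∈ e, (G.neighborSet a).ncard = 3 := by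
  simp only [GoodColoring, IsPackingEC, Sym2.forall, SimpleGraph.mem_edgeSet, Sym2.mem_iff,
    forall_eq_or_imp, forall_eq]
  constructor
  · rintro ⟨⟨h₁, h₂⟩, h₃⟩
    refine ⟨fun a b hab x y hxy hne hc => ?_, h₃⟩
    by_cases h0 : c s(a, b) = 0
    · have := h₁ a b x y hab hxy hne h0 (hc ▸ h0)
      tauto
    · have := h₂ a b x y hab hxy hne hc h0
      tauto
  · rintro ⟨h₁, h₂⟩
    refine ⟨⟨fun a b x y hab hxy hne h0 h0' => ?_, fun a b x y hab hxy hne hc h0 => ?_⟩, h₂⟩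
    · have := h₁ a b hab x y hxy hne (h0.trans h0'.symm)
      tauto
    · have := h₁ a b hab x y hxy hne hc
      tauto

/-- The graph obtained from `G` by deleting all edges that meet `T`. -/
def SimpleGraph.outside {V : Type} (G : SimpleGraph V) (T : Set V) : SimpleGraph V where
  Adj u v := G.Adj u v ∧ u ∉ T ∧ v ∉ T
  symm := ⟨fun _ _ h => ⟨h.1.symm, h.2.2, h.2.1⟩⟩
  loopless := ⟨fun _ h => h.1.ne rfl⟩

lemma outside_le {V : Type} (G : SimpleGraph V) (T : Set V) : G.outside T ≤ G :=
  fun _ _ h => h.1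

lemma Subcubic.mono {V : Type} [Finite V] {G H : SimpleGraph V} (hG : Subcubic G) (h : H ≤ G) :
    Subcubic H :=
  fun v => (Set.ncard_le_ncard (fun _ hw => h hw) (Set.toFinite _)).trans (hG v)

lemma ncard_neighborSet_outside_add_one_le {V : Type} [Finite V] {G : SimpleGraph V} {T : Set V}
    {a u : V} (ha : a ∈ T) (hau : G.Adj a u) :
    ((G.outside T).neighborSet u).ncard + 1 ≤ (G.neighborSet u).ncard := by
  rw [← Set.ncard_insert_of_notMem (a := a) (fun h => h.2.2 ha) (Set.toFinite _)]
  refine Set.ncard_le_ncard (Set.insert_subset hau.symm fun w hw => hw.1) (Set.toFinite _)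

lemma ncard_neighborSet_outside_add_two_le {V : Type} [Finite V] {G : SimpleGraph V} {T : Set V}
    {a b u : V} (hab : a ≠ b) (ha : a ∈ T) (hb : b ∈ T) (hau : G.Adj a u) (hbu : G.Adj b u) :
    ((G.outside T).neighborSet u).ncard + 2 ≤ (G.neighborSet u).ncard := by
  have h : a ∉ insert b ((G.outside T).neighborSet u) := by
    rintro (h | h)
    · exact hab h
    · exact h.2.2 ha
  have h₁ := Set.ncard_insert_of_notMem (s := (G.outside T).neighborSet u) (a := b)
    (fun h => h.2.2 hb) (Set.toFinite _)
  have h₂ := Set.ncard_insert_of_notMem h (Set.toFinite _)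
  have h₃ : (insert a (insert b ((G.outside T).neighborSet u))).ncard ≤ (G.neighborSet u).ncard :=
    Set.ncard_le_ncard (Set.insert_subset hau.symm (Set.insert_subset hbu.symm fun w hw => hw.1))
      (Set.toFinite _)
  omega

/-- The vertices `t 0`, `t 1`, `t 2` form a triangle of `G`. -/
structure IsTriangle {V : Type} (G : SimpleGraph V) (t : Fin 3 → V) : Prop where
  adj : ∀ i j, i ≠ j → G.Adj (t i) (t j)

namespace IsTriangle

variable {V : Type} {G : SimpleGraph V} {t : Fin 3 → V}

lemma injective (ht : IsTriangle G t) : Function.Injective t := by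
  intro i j h
  by_contra hij
  exact (ht.adj i j hij).ne h

lemma ncard_add_two_le [Finite V] (ht : IsTriangle G t) {i : Fin 3} {s : Set V}
    (hs : s ⊆ G.neighborSet (t i)) (hst : ∀ u ∈ s, u ∉ Set.range t) :
    s.ncard + 2 ≤ (G.neighborSet (t i)).ncard := by
  have h₁ : (t '' {i}ᶜ).ncard = 2 := by
    rw [Set.ncard_image_of_injective _ ht.injective, Set.ncard_compl, Set.ncard_singleton]
    simp
  have h₂ : Disjoint s (t '' {i}ᶜ) := by
    rw [Set.disjoint_left]
    rintro u hu ⟨j, -, rfl⟩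
    exact hst _ hu ⟨j, rfl⟩
  rw [← h₁, ← Set.ncard_union_eq h₂ (Set.toFinite _) (Set.toFinite _)]
  refine Set.ncard_le_ncard (Set.union_subset hs ?_) (Set.toFinite _)
  rintro _ ⟨j, hj, rfl⟩
  exact ht.adj i j (Ne.symm hj)

lemma ncard_neighborSet [Finite V] (ht : IsTriangle G t) (hG : Subcubic G) {i : Fin 3} {u : V}
    (hu : u ∉ Set.range t) (hiu : G.Adj (t i) u) : (G.neighborSet (t i)).ncard = 3 := by
  have h := ht.ncard_add_two_le (i := i) (s := {u}) (by simpa using hiu) (by simpa using hu)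
  have := hG (t i)
  rw [Set.ncard_singleton] at h
  omega

lemma outer_unique [Finite V] (ht : IsTriangle G t) (hG : Subcubic G) {i : Fin 3} {u v : V}
    (hu : u ∉ Set.range t) (hv : v ∉ Set.range t) (hiu : G.Adj (t i) u) (hiv : G.Adj (t i) v) :
    u = v := by
  by_contra huv
  have h := ht.ncard_add_two_le (i := i) (s := {u, v})
    (Set.insert_subset hiu (by simpa using hiv)) (by rintro w (rfl | rfl) <;> assumption)
  have := hG (t i)
  rw [Set.ncard_pair huv] at h
  omega

lemma edge_cases (e : Sym2 V) (he : e ∈ G.edgeSet) :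
    (∃ a b, e = s(a, b) ∧ (G.outside (Set.range t)).Adj a b) ∨
    (∃ i u, e = s(t i, u) ∧ u ∉ Set.range t ∧ G.Adj (t i) u) ∨
    ∃ i j, e = s(t i, t j) ∧ i ≠ j := by
  induction e with | _ a b
  rw [SimpleGraph.mem_edgeSet] at he
  by_cases ha : a ∈ Set.range t <;> by_cases hb : b ∈ Set.range t
  · obtain ⟨i, rfl⟩ := ha
    obtain ⟨j, rfl⟩ := hb
    exact Or.inr (Or.inr ⟨i, j, rfl, fun h => he.ne (h ▸ rfl)⟩)
  · obtain ⟨i, rfl⟩ := ha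
    exact Or.inr (Or.inl ⟨i, b, rfl, hb, he⟩)
  · obtain ⟨i, rfl⟩ := hb
    exact Or.inr (Or.inl ⟨i, a, Sym2.eq_swap, ha, he.symm⟩)
  · exact Or.inl ⟨a, b, rfl, he, ha, hb⟩

/-- The coloring with color `x k` on the triangle edge `s(t i, t j)`, where `{i, j, k}` is the
whole index set, with `p i` on the other edges at `t i`, and agreeing with `c` elsewhere. -/
lemma exists_glued_coloring (ht : IsTriangle G t) (c : Sym2 V → Fin 8) (x p : Fin 3 → Fin 8) :
    ∃ c' : Sym2 V → Fin 8, (∀ i j, c' s(t i, t j) = x (-(i + j))) ∧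
      (∀ i, ∀ u ∉ Set.range t, c' s(t i, u) = p i) ∧
      ∀ u ∉ Set.range t, ∀ v ∉ Set.range t, c' s(u, v) = c s(u, v) := by
  classical
  obtain ⟨r, hr⟩ := ht.injective.hasLeftInverse
  refine ⟨Sym2.lift ⟨fun a b => if a ∈ Set.range t then
      if b ∈ Set.range t then x (-(r a + r b)) else p (r a)
    else if b ∈ Set.range t then p (r b) else c s(a, b), fun a b => ?_⟩, ?_, ?_, ?_⟩
  · by_cases ha : a ∈ Set.range t <;> by_cases hb : b ∈ Set.range t <;>
      simp [ha, hb, add_comm, Sym2.eq_swap]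
  · intro i j
    simp [hr i, hr j]
  · intro i u hu
    simp only [Sym2.lift_mk, Set.mem_range_self, if_true, hu, if_false, hr i]
  · intro u hu v hv
    simp only [Sym2.lift_mk, hu, hv, if_false]

lemma exists_goodColoring_of_extension [Finite V] (ht : IsTriangle G t) (hG : Subcubic G)
    {c : Sym2 V → Fin 8} (hc : GoodColoring (G.outside (Set.range t)) c) {x p : Fin 3 → Fin 8}
    (hx : Function.Injective x) (hpx : ∀ i j, p i ≠ x j)
    (hpp : ∀ i j, p i = p j → p i ≠ 0 → i = j)
    (hxS : ∀ i j, i ≠ j → ∀ u w, G.Adj (t j) u → (G.outside (Set.range t)).Adj u w →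
      c s(u, w) ≠ x i)
    (hpF : ∀ i, p i ≠ 0 → ∀ u w z, G.Adj (t i) u → (G.outside (Set.range t)).Adj u w →
      (G.outside (Set.range t)).Adj w z → c s(w, z) ≠ p i)
    (hp0 : ∀ i u, p i = 0 → u ∉ Set.range t → G.Adj (t i) u →
      2 ≤ ((G.outside (Set.range t)).neighborSet u).ncard)
    (hx0 : ∀ i, x i = 0 → ∀ j, ∃ u ∉ Set.range t, G.Adj (t j) u) :
    ∃ c', GoodColoring G c' := by
  obtain ⟨c', hcx, hcp, hcc⟩ := ht.exists_glued_coloring c x p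
  obtain ⟨hc₁, hc₂⟩ := goodColoring_iff.1 hc
  set H := G.outside (Set.range t) with hH
  let Compat : Sym2 V → Sym2 V → Prop := fun e f =>
    ∀ a ∈ e, ∀ b ∈ f, a ≠ b ∧ (c' e ≠ 0 → ¬G.Adj a b)
  have symm : ∀ e f, c' e = c' f → Compat f e → Compat e f := fun e f hef h a ha b hb =>
    ⟨(h b hb a ha).1.symm, fun h0 hab => (h b hb a ha).2 (hef ▸ h0) hab.symm⟩
  have zero_notMem : ∀ i u w, G.Adj (t i) u → H.Adj u w → c s(u, w) ≠ 0 := by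
    intro i u w hiu huw h0
    have h₁ := hc₂ s(u, w) huw h0 u (by simp)
    have h₂ := ncard_neighborSet_outside_add_one_le (Set.mem_range_self i) hiu
    rw [← hH] at h₂
    have := hG u
    omega
  have old_pendant : ∀ a b i u, H.Adj a b → u ∉ Set.range t → G.Adj (t i) u →
      c' s(a, b) = c' s(t i, u) → Compat s(a, b) s(t i, u) := by
    intro a b i u hab hu hiu heq
    have key : ∀ a b, H.Adj a b → c s(a, b) = p i →
        a ≠ u ∧ (p i ≠ 0 → ¬G.Adj a (t i) ∧ ¬G.Adj a u) := by
      intro a b hab heq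
      refine ⟨?_, fun h0 => ⟨fun h => ?_, fun h => ?_⟩⟩
      · intro hau
        by_cases h0 : p i = 0
        · exact zero_notMem i a b (hau ▸ hiu) hab (heq.trans h0)
        · exact hpF i h0 _ _ _ (hau ▸ hiu) hab hab.symm (Sym2.eq_swap ▸ heq)
      · exact hpF i h0 _ _ _ h.symm hab hab.symm (Sym2.eq_swap ▸ heq)
      · exact hpF i h0 _ _ _ hiu ⟨h.symm, hu, hab.2.1⟩ hab heq
    have hcab := hcc a hab.2.1 b hab.2.2
    rw [hcab, hcp i u hu] at heq
    have ha := key a b hab heq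
    have hb := key b a hab.symm (Sym2.eq_swap ▸ heq)
    have hat : a ≠ t i := fun h => hab.2.1 ⟨i, h.symm⟩
    have hbt : b ≠ t i := fun h => hab.2.2 ⟨i, h.symm⟩
    simp only [Compat, hcab, heq, Sym2.mem_iff, forall_eq_or_imp, forall_eq]
    tauto
  have old_triangle : ∀ a b i j, H.Adj a b → i ≠ j →
      c' s(a, b) = c' s(t i, t j) → Compat s(a, b) s(t i, t j) := by
    intro a b i j hab hij heq
    have hcab := hcc a hab.2.1 b hab.2.2
    rw [hcab, hcx] at heq
    have hi : -(i + j) ≠ i := by clear heq; revert i j; decide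
    have hj : -(i + j) ≠ j := by clear hi heq; revert i j; decide
    have key : ∀ a b, H.Adj a b → c s(a, b) = x (-(i + j)) →
        a ≠ t i ∧ a ≠ t j ∧ ¬G.Adj a (t i) ∧ ¬G.Adj a (t j) := fun a b hab heq =>
      ⟨fun h => hab.2.1 ⟨i, h.symm⟩, fun h => hab.2.1 ⟨j, h.symm⟩,
        fun h => hxS _ _ hi _ _ h.symm hab heq, fun h => hxS _ _ hj _ _ h.symm hab heq⟩
    have ha := key a b hab heq
    have hb := key b a hab.symm (Sym2.eq_swap ▸ heq)
    simp only [Compat, Sym2.mem_iff, forall_eq_or_imp, forall_eq]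
    tauto
  have pendant_pendant : ∀ i u j v, u ∉ Set.range t → G.Adj (t i) u → v ∉ Set.range t →
      G.Adj (t j) v → s(t i, u) ≠ s(t j, v) → c' s(t i, u) = c' s(t j, v) →
      Compat s(t i, u) s(t j, v) := by
    intro i u j v hu hiu hv hjv hne heq
    have hij : i ≠ j := by
      rintro rfl
      exact hne (by rw [ht.outer_unique hG hu hv hiu hjv])
    have hci := hcp i u hu
    rw [hci, hcp j v hv] at heq
    have h0 : p i = 0 := by
      by_contra h0
      exact hij (hpp i j heq h0)
    have huv : u ≠ v := by
      rintro rfl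
      have h₁ := ncard_neighborSet_outside_add_two_le (ht.adj i j hij).ne (Set.mem_range_self i)
        (Set.mem_range_self j) hiu hjv
      rw [← hH] at h₁
      have := hp0 i u h0 hu hiu
      have := hG u
      omega
    have h₁ : t i ≠ v := fun h => hv ⟨i, h⟩
    have h₂ : u ≠ t j := fun h => hu ⟨j, h.symm⟩
    have h₃ := (ht.adj i j hij).ne
    simp only [Compat, hci, h0, Sym2.mem_iff, forall_eq_or_imp, forall_eq]
    tauto
  refine ⟨c', goodColoring_iff.2 ⟨fun e he f hf hef heq => ?_, fun e he h0 => ?_⟩⟩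
  · change Compat e f
    rcases edge_cases (t := t) e he with
        ⟨a, b, rfl, hab⟩ | ⟨i, u, rfl, hu, hiu⟩ | ⟨i, j, rfl, hij⟩ <;>
      rcases edge_cases (t := t) f hf with
        ⟨a', b', rfl, hab'⟩ | ⟨i', u', rfl, hu', hiu'⟩ | ⟨i', j', rfl, hij'⟩
    · have hcab := hcc a hab.2.1 b hab.2.2
      rw [hcab, hcc a' hab'.2.1 b' hab'.2.2] at heq
      intro y hy z hz
      obtain ⟨h₁, h₂⟩ := hc₁ _ hab _ hab' hef heq y hy z hz
      refine ⟨h₁, fun h0 hyz => h₂ (hcab ▸ h0) ⟨hyz, ?_, ?_⟩⟩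
      · rcases Sym2.mem_iff.1 hy with rfl | rfl
        exacts [hab.2.1, hab.2.2]
      · rcases Sym2.mem_iff.1 hz with rfl | rfl
        exacts [hab'.2.1, hab'.2.2]
    · exact old_pendant _ _ _ _ hab hu' hiu' heq
    · exact old_triangle _ _ _ _ hab hij' heq
    · exact symm _ _ heq (old_pendant _ _ _ _ hab' hu hiu heq.symm)
    · exact pendant_pendant _ _ _ _ hu hiu hu' hiu' hef heq
    · rw [hcp i u hu, hcx] at heq
      exact absurd heq (hpx _ _)
    · exact symm _ _ heq (old_triangle _ _ _ _ hab' hij heq.symm)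
    · rw [hcp i' u' hu', hcx] at heq
      exact absurd heq.symm (hpx _ _)
    · rw [hcx, hcx] at heq
      have h : s(i, j) = s(i', j') := by
        have := hx heq
        clear heq hef he hf
        revert i j i' j'
        decide
      exact absurd (congrArg (Sym2.map t) h) hef
  · rcases edge_cases (t := t) e he with ⟨a, b, rfl, hab⟩ | ⟨i, u, rfl, hu, hiu⟩ | ⟨i, j, rfl, hij⟩
    · rw [hcc a hab.2.1 b hab.2.2] at h0
      intro y hy
      have h₁ := hc₂ _ hab h0 y hy
      have h₂ : (H.neighborSet y).ncard ≤ (G.neighborSet y).ncard :=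
        Set.ncard_le_ncard (fun w hw => hw.1) (Set.toFinite _)
      have := hG y
      omega
    · rw [hcp i u hu] at h0
      have h₁ := hp0 i u h0 hu hiu
      have h₂ := ncard_neighborSet_outside_add_one_le (Set.mem_range_self i) hiu
      rw [← hH] at h₂
      have h₃ := hG u
      simp only [Sym2.mem_iff, forall_eq_or_imp, forall_eq]
      exact ⟨ht.ncard_neighborSet hG hu hiu, by omega⟩
    · rw [hcx] at h0
      have key : ∀ k, (G.neighborSet (t k)).ncard = 3 := by
        intro k
        obtain ⟨u, hu, hku⟩ := hx0 _ h0 k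
        exact ht.ncard_neighborSet hG hu hku
      simp only [Sym2.mem_iff, forall_eq_or_imp, forall_eq]
      exact ⟨key i, key j⟩

lemma edgeSet_outside_ncard_lt [Finite V] (ht : IsTriangle G t) :
    (G.outside (Set.range t)).edgeSet.ncard < G.edgeSet.ncard := by
  refine Set.ncard_lt_ncard (SimpleGraph.edgeSet_strict_mono ?_) (Set.toFinite _)
  refine lt_of_le_of_ne (outside_le _ _) fun h => ?_
  have h₁ := ht.adj 0 1 (by decide)
  rw [← h] at h₁
  exact h₁.2.1 ⟨0, rfl⟩

end IsTriangle

lemma card_colors_le {V : Type} [Finite V] {H : SimpleGraph V} {c : Sym2 V → Fin 8} {v : V}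
    {A : Finset (Fin 8)} (hA : ∀ y ∈ A, ∃ w, H.Adj v w ∧ c s(v, w) = y) :
    A.card ≤ (H.neighborSet v).ncard := by
  rw [← Set.ncard_coe_finset]
  refine (Set.ncard_le_ncard (t := (fun w => c s(v, w)) '' H.neighborSet v) ?_
    (Set.toFinite _)).trans (Set.ncard_image_le (Set.toFinite _))
  exact fun y hy => hA y hy

theorem exists_goodColoring_of_triangle {V : Type} [Finite V] {G : SimpleGraph V}
    {t : Fin 3 → V} (ht : IsTriangle G t) (hG : Subcubic G) {c : Sym2 V → Fin 8}
    (hc : GoodColoring (G.outside (Set.range t)) c) : ∃ c', GoodColoring G c' := by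
  classical
  set H := G.outside (Set.range t) with hH
  let S : Fin 3 → Finset (Fin 8) := fun i =>
    {y | ∃ u w, G.Adj (t i) u ∧ H.Adj u w ∧ c s(u, w) = y}
  let F : Fin 3 → Finset (Fin 8) := fun i =>
    {y | ∃ u w z, G.Adj (t i) u ∧ H.Adj u w ∧ H.Adj w z ∧ c s(w, z) = y}
  let B : Finset (Fin 3) :=
    {i | ∃ u ∉ Set.range t, G.Adj (t i) u ∧ (H.neighborSet u).ncard ≤ 1}
  have hdeg : ∀ i u, G.Adj (t i) u → (H.neighborSet u).ncard ≤ 2 := by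
    intro i u hiu
    have h₁ := ncard_neighborSet_outside_add_one_le (Set.mem_range_self i) hiu
    rw [← hH] at h₁
    have := hG u
    omega
  have hScard : ∀ i u, u ∉ Set.range t → G.Adj (t i) u →
      (S i).card ≤ (H.neighborSet u).ncard := by
    intro i u hu hiu
    refine card_colors_le (c := c) fun y hy => ?_
    obtain ⟨v, w, hiv, hvw, rfl⟩ := (Finset.mem_filter.1 hy).2
    obtain rfl := ht.outer_unique hG hu hvw.2.1 hiu hiv
    exact ⟨w, hvw, rfl⟩
  have hS : ∀ i, (S i).card ≤ 2 := by
    intro i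
    by_cases h : ∃ u ∉ Set.range t, G.Adj (t i) u
    · obtain ⟨u, hu, hiu⟩ := h
      exact (hScard i u hu hiu).trans (hdeg i u hiu)
    · have : S i = ∅ := Finset.filter_eq_empty_iff.2 fun y _ ⟨u, w, hiu, huw, _⟩ =>
        h ⟨u, huw.2.1, hiu⟩
      simp [this]
  have hSB : ∀ i ∈ B, (S i).card ≤ 1 := by
    intro i hi
    obtain ⟨u, hu, hiu, h1⟩ := (Finset.mem_filter.1 hi).2
    exact (hScard i u hu hiu).trans h1
  have hF : ∀ i ∈ B, (F i).card ≤ 3 := by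
    intro i hi
    obtain ⟨u, hu, hiu, h1⟩ := (Finset.mem_filter.1 hi).2
    by_cases h : ∃ w, H.Adj u w
    · obtain ⟨w, huw⟩ := h
      refine (card_colors_le (H := H) (c := c) (v := w) fun y hy => ?_).trans
        (hG.mono (outside_le _ _) w)
      obtain ⟨u', w', z, hiu', huw', hwz, rfl⟩ := (Finset.mem_filter.1 hy).2
      obtain rfl := ht.outer_unique hG hu huw'.2.1 hiu hiu'
      obtain rfl := (Set.ncard_le_one (Set.toFinite _)).1 h1 w huw w' huw'
      exact ⟨z, hwz, rfl⟩
    · have : F i = ∅ := Finset.filter_eq_empty_iff.2 fun y _ ⟨u', w, z, hiu', huw, _⟩ =>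
        h ⟨w, by rwa [ht.outer_unique hG hu huw.2.1 hiu hiu']⟩
      simp [this]
  have h0 : ∀ i, 0 ∉ S i := by
    intro i hi
    obtain ⟨u, w, hiu, huw, h⟩ := (Finset.mem_filter.1 hi).2
    have := (hc.2 u w huw h).1
    have := hdeg i u hiu
    omega
  obtain ⟨x, p, hp0, hpF, hpp, hx, hpx, hxS, hx0⟩ := exists_triangle_colors S F B hS hSB hF h0
  refine ht.exists_goodColoring_of_extension hG hc hx hpx hpp ?_ ?_ ?_ ?_
  · intro i j hij u w hju huw h
    exact hxS i j hij (Finset.mem_filter.2 ⟨Finset.mem_univ _, u, w, hju, huw, h⟩)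
  · intro i hi u w z hiu huw hwz h
    refine hpF i (by_contra fun hB => hi ((hp0 i).2 hB)) ?_
    exact Finset.mem_filter.2 ⟨Finset.mem_univ _, u, w, z, hiu, huw, hwz, h⟩
  · intro i u hi hu hiu
    by_contra! h
    rw [← hH] at h
    exact (hp0 i).1 hi (Finset.mem_filter.2 ⟨Finset.mem_univ _, u, hu, hiu, by omega⟩)
  · intro i hi j
    obtain ⟨u, hu, hju, -⟩ := (Finset.mem_filter.1 (hx0 i hi j)).2
    exact ⟨u, hu, hju⟩

/-- A minimal counterexample contains no cycle of length 3. -/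
theorem minCounter_no_triangle {V : Type} [Finite V] (G : SimpleGraph V)
    (hG : MinCounter V G) :
    ∀ (v : V) (w : G.Walk v v), w.IsCycle → w.length ≠ 3 := by
  intro v w _ hw
  obtain ⟨hsub, hno, hmin⟩ := hG
  match w, hw with
  | .cons (v := a) hva (.cons (v := b) hab (.cons hbv .nil)), _ =>
    have ht : IsTriangle G ![v, a, b] := by
      refine ⟨fun i j => ?_⟩
      fin_cases i <;> fin_cases j <;> simp [hva, hab, hbv, hva.symm, hab.symm, hbv.symm]
    obtain ⟨c, hc⟩ := hmin V _ (hsub.mono (outside_le G (Set.range ![v, a, b])))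
      (Nat.add_lt_add_left ht.edgeSet_outside_ncard_lt _)
    exact hno (exists_goodColoring_of_triangle ht hsub hc)
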